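/- arXiv:1706.08637 — 6 statements merged into one kernel-verified Lean document; each statement's English description precedes it below -/
import Mathlib

section
/- Let g > 0, h0, h1 ∈ ℝ, α > 0, a < b, and let x0 = (a + b)/2 be the midpoint of [a, b]. Then the total initial energy of the smoothed dam-break profile (with zero initial velocity, so the Hamiltonian density reduces to (g/2)h(x)²) satisfies ∫_a^b (g/2)·h(x)² dx = (g/4)(b − a)(h0² + h1²) − (g/4)·α·(h1 − h0)²·tanh((b − a)/(2α)). -/
/-- The total initial energy of the smoothed dam-break profile (zero initial velocity,
Hamiltonian density `(g/2) h(x)²`) over `[a, b]` with `x0` the midpoint of `[a, b]`: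
`∫_a^b (g/2) h(x)² dx = (g/4)(b - a)(h0² + h1²) - (g/4) α (h1 - h0)² tanh((b - a)/(2α))`. -/
theorem smoothed_dam_break_total_energy (g h0 h1 α a b x0 : ℝ)
    (hg : 0 < g) (hα : 0 < α) (hab : a < b) (hx0 : x0 = (a + b) / 2) :
    ∫ x in a..b,
        g / 2 * (h0 + (h1 - h0) / 2 * (1 + Real.tanh ((x0 - x) / α))) ^ 2 =
      g / 4 * (b - a) * (h0 ^ 2 + h1 ^ 2) -
        g / 4 * α * (h1 - h0) ^ 2 * Real.tanh ((b - a) / (2 * α)) := by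
  have hc : ∀ y : ℝ, Real.cosh y ≠ 0 := fun y => (Real.cosh_pos y).ne'
  have hα' : α ≠ 0 := hα.ne'
  have hderiv : ∀ x ∈ Set.uIcc a b, HasDerivAt (fun x : ℝ =>
      g / 2 * ((((h0 + h1) / 2) ^ 2 + ((h1 - h0) / 2) ^ 2) * x
        - 2 * ((h0 + h1) / 2) * ((h1 - h0) / 2) * α * Real.log (Real.cosh ((x0 - x) / α))
        + ((h1 - h0) / 2) ^ 2 * α * (Real.sinh ((x0 - x) / α) / Real.cosh ((x0 - x) / α))))
      (g / 2 * (h0 + (h1 - h0) / 2 * (1 + Real.tanh ((x0 - x) / α))) ^ 2) x := by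
    intro x _
    have hy : HasDerivAt (fun x : ℝ => (x0 - x) / α) (-1 / α) x :=
      ((hasDerivAt_id x).const_sub x0).div_const α
    have hC := hy.cosh
    have hS := hy.sinh
    have h := ((((hasDerivAt_id x).const_mul
      (((h0 + h1) / 2) ^ 2 + ((h1 - h0) / 2) ^ 2)).sub
      ((hC.log (hc _)).const_mul (2 * ((h0 + h1) / 2) * ((h1 - h0) / 2) * α))).add
      ((hS.div hC (hc _)).const_mul (((h1 - h0) / 2) ^ 2 * α))).const_mul (g / 2)
    refine h.congr_deriv ?_
    rw [Real.tanh_eq_sinh_div_cosh]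
    have hcc := hc ((x0 - x) / α)
    generalize Real.cosh ((x0 - x) / α) = C at *
    generalize Real.sinh ((x0 - x) / α) = S at *
    field_simp
    ring
  have ht : Continuous Real.tanh := by
    have : Real.tanh = fun y => Real.sinh y / Real.cosh y :=
      funext Real.tanh_eq_sinh_div_cosh
    rw [this]
    exact Real.continuous_sinh.div Real.continuous_cosh hc
  have hint : IntervalIntegrable (fun x : ℝ =>
      g / 2 * (h0 + (h1 - h0) / 2 * (1 + Real.tanh ((x0 - x) / α))) ^ 2)
      MeasureTheory.volume a b := by
    apply Continuous.intervalIntegrable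
    have : Continuous fun x : ℝ => Real.tanh ((x0 - x) / α) :=
      ht.comp ((continuous_const.sub continuous_id).div_const α)
    fun_prop
  rw [intervalIntegral.integral_eq_sub_of_hasDerivAt hderiv hint]
  have e1 : (x0 - b) / α = -((b - a) / (2 * α)) := by rw [hx0]; field_simp; ring
  have e2 : (x0 - a) / α = (b - a) / (2 * α) := by rw [hx0]; field_simp; ring
  simp only [e1, e2, Real.tanh_eq_sinh_div_cosh, Real.cosh_neg, Real.sinh_neg]
  ring
end

section
/- Let g ∈ ℝ, a < b, and let h, u : ℝ × ℝ → ℝ be three times continuously differentiable functions of (x, t) satisfying the Serre momentum equation ∂(uh)/∂t + ∂/∂x( u²h + g h²/2 + (h³/3)( (∂u/∂x)² − u·∂²u/∂x² − ∂²u/∂x∂t ) ) = 0 at every point of ℝ². Suppose that at both boundaries x = a and x = b, for all t ∈ ℝ, one has u = 0, ∂u/∂x = 0 and ∂²u/∂x∂t = 0. Then for every t the total momentum M(t) = ∫_a^b u(x, t)·h(x, t) dx is differentiable in t with derivative M′(t) = (g/2)·( h(a, t)² − h(b, t)² ). -/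
lemma aux_dx (F : ℝ × ℝ → ℝ) (hF : Differentiable ℝ F) (x t : ℝ) :
    HasDerivAt (fun z => F (z, t)) (fderiv ℝ F (x, t) (1, 0)) x :=
  (hF (x, t)).hasFDerivAt.comp_hasDerivAt x ((hasDerivAt_id x).prodMk (hasDerivAt_const x t))

lemma aux_dt (F : ℝ × ℝ → ℝ) (hF : Differentiable ℝ F) (x t : ℝ) :
    HasDerivAt (fun s => F (x, s)) (fderiv ℝ F (x, t) (0, 1)) t :=
  (hF (x, t)).hasFDerivAt.comp_hasDerivAt t ((hasDerivAt_const t x).prodMk (hasDerivAt_id t))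

lemma aux_cd (F : ℝ × ℝ → ℝ) (m n : WithTop ℕ∞) (hF : ContDiff ℝ n F) (hmn : m + 1 ≤ n)
    (v : ℝ × ℝ) : ContDiff ℝ m (fun p => fderiv ℝ F p v) :=
  (hF.fderiv_right hmn).clm_apply contDiff_const

lemma aux_leibniz (a b : ℝ) (F : ℝ × ℝ → ℝ) (hF : ContDiff ℝ 1 F) (t : ℝ) :
    HasDerivAt (fun s => ∫ x in a..b, F (x, s)) (∫ x in a..b, fderiv ℝ F (x, t) (0, 1)) t := by
  have hd : Differentiable ℝ F := hF.differentiable (by norm_num)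
  have hc : Continuous (fun p => fderiv ℝ F p (0, 1)) :=
    (aux_cd F 0 1 hF (by norm_num) (0, 1)).continuous
  have hK : IsCompact (Set.uIcc a b ×ˢ Set.Icc (t - 1) (t + 1)) :=
    isCompact_uIcc.prod isCompact_Icc
  obtain ⟨C, hC⟩ := hK.exists_bound_of_continuousOn hc.continuousOn
  refine (intervalIntegral.hasDerivAt_integral_of_dominated_loc_of_deriv_le
    (F := fun s x => F (x, s)) (F' := fun s x => fderiv ℝ F (x, s) (0, 1))
    (bound := fun _ => C)
    (Icc_mem_nhds (by linarith : t - 1 < t) (by linarith : t < t + 1)) ?_ ?_ ?_ ?_ ?_ ?_).2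
  · exact Filter.Eventually.of_forall fun s =>
      (hF.continuous.comp (by fun_prop : Continuous fun x : ℝ => (x, s))).aestronglyMeasurable
  · exact (hF.continuous.comp (by fun_prop : Continuous fun x : ℝ => (x, t))).intervalIntegrable _ _
  · exact (hc.comp (by fun_prop : Continuous fun x : ℝ => (x, t))).aestronglyMeasurable
  · exact Filter.Eventually.of_forall fun x hx s hs =>
      hC (x, s) ⟨Set.uIoc_subset_uIcc hx, hs⟩
  · exact intervalIntegrable_const
  · exact Filter.Eventually.of_forall fun x _ s _ => aux_dt F hd x s

/-- If `h, u : ℝ × ℝ → ℝ` are three times continuously differentiable and satisfy the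
Serre momentum equation
`∂(uh)/∂t + ∂/∂x(u²h + g h²/2 + (h³/3)((∂u/∂x)² − u ∂²u/∂x² − ∂²u/∂x∂t)) = 0`
everywhere, and at both boundaries `x = a` and `x = b` one has `u = 0`, `∂u/∂x = 0` and
`∂²u/∂x∂t = 0` for all times, then the total momentum `M(t) = ∫_a^b u h dx` has
derivative `M′(t) = (g/2)(h(a,t)² − h(b,t)²)`. -/
theorem serre_momentum_flux (g a b : ℝ) (hab : a < b)
    (h u : ℝ × ℝ → ℝ) (hh : ContDiff ℝ 3 h) (hu : ContDiff ℝ 3 u)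
    (hmom : ∀ x t : ℝ,
      deriv (fun s => u (x, s) * h (x, s)) t +
        deriv (fun y =>
          u (y, t) ^ 2 * h (y, t) + g * h (y, t) ^ 2 / 2 +
            h (y, t) ^ 3 / 3 *
              ((deriv (fun z => u (z, t)) y) ^ 2 -
                u (y, t) * deriv (fun z => deriv (fun w => u (w, t)) z) y -
                deriv (fun s => deriv (fun z => u (z, s)) y) t)) x = 0)
    (hbca : ∀ t : ℝ, u (a, t) = 0 ∧ deriv (fun z => u (z, t)) a = 0 ∧
      deriv (fun s => deriv (fun z => u (z, s)) a) t = 0)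
    (hbcb : ∀ t : ℝ, u (b, t) = 0 ∧ deriv (fun z => u (z, t)) b = 0 ∧
      deriv (fun s => deriv (fun z => u (z, s)) b) t = 0) :
    ∀ t : ℝ, HasDerivAt (fun s => ∫ x in a..b, u (x, s) * h (x, s))
      (g / 2 * (h (a, t) ^ 2 - h (b, t) ^ 2)) t := by
  intro t
  have hud : Differentiable ℝ u := hu.differentiable (by norm_num)
  have hhd : Differentiable ℝ h := hh.differentiable (by norm_num)
  have hux : ContDiff ℝ 2 (fun p => fderiv ℝ u p (1, 0)) :=
    aux_cd u 2 3 hu (by norm_num) _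
  have huxd := hux.differentiable (by norm_num)
  have huxx := (aux_cd _ 1 2 hux (by norm_num) (1, 0)).differentiable (by norm_num)
  have huxt := (aux_cd _ 1 2 hux (by norm_num) (0, 1)).differentiable (by norm_num)
  have e1 : ∀ y s, deriv (fun z => u (z, s)) y = fderiv ℝ u (y, s) (1, 0) :=
    fun y s => (aux_dx u hud y s).deriv
  have e2 : ∀ y s, deriv (fun z => fderiv ℝ u (z, s) (1, 0)) y =
      fderiv ℝ (fun p => fderiv ℝ u p (1, 0)) (y, s) (1, 0) :=
    fun y s => (aux_dx _ huxd y s).deriv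
  have e3 : ∀ y s, deriv (fun z => fderiv ℝ u (y, z) (1, 0)) s =
      fderiv ℝ (fun p => fderiv ℝ u p (1, 0)) (y, s) (0, 1) :=
    fun y s => (aux_dt _ huxd y s).deriv
  have hF : ContDiff ℝ 1 (fun p => u p * h p) :=
    (hu.mul hh).of_le (by norm_num)
  have hFd := hF.differentiable (by norm_num)
  have e4 : ∀ y s, deriv (fun s => u (y, s) * h (y, s)) s =
      fderiv ℝ (fun p => u p * h p) (y, s) (0, 1) :=
    fun y s => (aux_dt _ hFd y s).deriv
  simp only [e1, e2, e3, e4] at hmom hbca hbcb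
  have hL := aux_leibniz a b _ hF t
  have hc : Continuous (fun x => fderiv ℝ (fun p => u p * h p) (x, t) (0, 1)) :=
    (aux_cd _ 0 1 hF (by norm_num) (0, 1)).continuous.comp
      (by fun_prop : Continuous fun x : ℝ => (x, t))
  have h3 : Differentiable ℝ (fun p : ℝ × ℝ => h p ^ 3 / 3) := by fun_prop
  have h2 : Differentiable ℝ (fun p : ℝ × ℝ => g * h p ^ 2 / 2) := by fun_prop
  have hG : Differentiable ℝ (fun p : ℝ × ℝ => u p ^ 2 * h p + g * h p ^ 2 / 2 +
      h p ^ 3 / 3 * ((fderiv ℝ u p (1, 0)) ^ 2 -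
        u p * fderiv ℝ (fun p => fderiv ℝ u p (1, 0)) p (1, 0) -
        fderiv ℝ (fun p => fderiv ℝ u p (1, 0)) p (0, 1))) :=
    (((hud.pow 2).mul hhd).add h2).add
      (h3.mul (((huxd.pow 2).sub (hud.mul huxx)).sub huxt))
  have hderiv : ∀ x ∈ Set.uIcc a b, HasDerivAt (fun y =>
      u (y, t) ^ 2 * h (y, t) + g * h (y, t) ^ 2 / 2 +
      h (y, t) ^ 3 / 3 * ((fderiv ℝ u (y, t) (1, 0)) ^ 2 -
        u (y, t) * fderiv ℝ (fun p => fderiv ℝ u p (1, 0)) (y, t) (1, 0) -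
        fderiv ℝ (fun p => fderiv ℝ u p (1, 0)) (y, t) (0, 1)))
      (-fderiv ℝ (fun p => u p * h p) (x, t) (0, 1)) x := by
    intro x _
    have hx := (aux_dx _ hG x t).differentiableAt.hasDerivAt
    have hm := hmom x t
    rw [← eq_neg_iff_add_eq_zero] at hm
    rw [hm, neg_neg]
    exact hx
  have hI := intervalIntegral.integral_eq_sub_of_hasDerivAt hderiv
    (hc.neg.intervalIntegrable _ _)
  obtain ⟨a1, a2, a3⟩ := hbca t
  obtain ⟨b1, b2, b3⟩ := hbcb t
  rw [intervalIntegral.integral_neg] at hI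
  simp only [a1, a2, a3, b1, b2, b3] at hI
  convert hL using 1
  linarith
end

section
/- Let Δ > 1. Then there exists exactly one A ∈ (0, 15) satisfying the Whitham modulation equation of El, Grimshaw and Smyth for the leading-wave amplitude of an undular bore: Δ/(A + 1)^{1/4} = (3/(4 − √(A + 1)))^{21/10} · (2/(1 + √(A + 1)))^{2/5}. -/
noncomputable def whF (s : ℝ) : ℝ :=
  s ^ ((1 : ℝ) / 10) * (2 * s / (1 + s)) ^ ((2 : ℝ) / 5) * (3 / (4 - s)) ^ ((21 : ℝ) / 10)

lemma whF_strictMono : StrictMonoOn whF (Set.Ico 1 4) := by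
  rintro x ⟨hx1, hx4⟩ y ⟨hy1, hy4⟩ hxy
  have hx0 : 0 < x := by linarith
  have hy0 : 0 < y := by linarith
  have h4x : 0 < 4 - x := by linarith
  have h4y : 0 < 4 - y := by linarith
  unfold whF
  have h1 : x ^ ((1 : ℝ) / 10) < y ^ ((1 : ℝ) / 10) :=
    Real.rpow_lt_rpow hx0.le hxy (by norm_num)
  have h2 : (2 * x / (1 + x)) ^ ((2 : ℝ) / 5) < (2 * y / (1 + y)) ^ ((2 : ℝ) / 5) := by
    apply Real.rpow_lt_rpow (by positivity) _ (by norm_num)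
    rw [div_lt_div_iff₀ (by linarith) (by linarith)]
    nlinarith
  have h3 : (3 / (4 - x)) ^ ((21 : ℝ) / 10) < (3 / (4 - y)) ^ ((21 : ℝ) / 10) := by
    apply Real.rpow_lt_rpow (by positivity) _ (by norm_num)
    rw [div_lt_div_iff₀ (by linarith) (by linarith)]
    nlinarith
  have := mul_lt_mul'' h1 h2 (by positivity) (by positivity)
  exact mul_lt_mul'' this h3 (by positivity) (by positivity)

lemma whF_one : whF 1 = 1 := by
  unfold whF; norm_num

lemma whF_cont (b : ℝ) (hb : b < 4) : ContinuousOn whF (Set.Icc 1 b) := by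
  unfold whF
  refine ContinuousOn.mul (ContinuousOn.mul ?_ ?_) ?_
  · exact ContinuousOn.rpow_const continuousOn_id (fun x _ => Or.inr (by norm_num))
  · refine ContinuousOn.rpow_const (ContinuousOn.div (by fun_prop) (by fun_prop) ?_)
      (fun x _ => Or.inr (by norm_num))
    rintro x ⟨h1, h2⟩
    linarith
  · refine ContinuousOn.rpow_const (ContinuousOn.div (by fun_prop) (by fun_prop) ?_)
      (fun x _ => Or.inr (by norm_num))
    rintro x ⟨h1, h2⟩
    linarith

lemma whF_big (Δ : ℝ) (hΔ : 1 < Δ) : Δ < whF (4 - 3 / Δ) := by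
  have h0 : 0 < Δ := by linarith
  have h3 : 3 / Δ < 3 := by rw [div_lt_iff₀ h0]; linarith
  have hs : 1 < 4 - 3 / Δ := by linarith
  unfold whF
  have e : 3 / (4 - (4 - 3 / Δ)) = Δ := by field_simp; ring
  rw [e]
  generalize 4 - 3 / Δ = s at hs
  have h1 : 1 < s ^ ((1 : ℝ) / 10) := Real.one_lt_rpow hs (by norm_num)
  have h2 : 1 < (2 * s / (1 + s)) ^ ((2 : ℝ) / 5) := by
    apply Real.one_lt_rpow _ (by norm_num)
    rw [lt_div_iff₀ (by linarith)]; linarith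
  have h4 : Δ < Δ ^ ((21 : ℝ) / 10) := Real.self_lt_rpow_of_one_lt hΔ (by norm_num)
  have h5 := one_lt_mul_of_lt_of_le h1 h2.le
  nlinarith [h5, h4, h0]

lemma wh_iff (Δ A : ℝ) (hA : A ∈ Set.Ioo (0 : ℝ) 15) :
    Δ / (A + 1) ^ ((1 : ℝ) / 4) =
        (3 / (4 - Real.sqrt (A + 1))) ^ ((21 : ℝ) / 10) *
          (2 / (1 + Real.sqrt (A + 1))) ^ ((2 : ℝ) / 5) ↔ whF (Real.sqrt (A + 1)) = Δ := by
  have hA1 : 0 < A + 1 := by linarith [hA.1]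
  have hs : 0 < Real.sqrt (A + 1) := Real.sqrt_pos.2 hA1
  have e : (A + 1) ^ ((1 : ℝ) / 4) = Real.sqrt (A + 1) ^ ((1 : ℝ) / 10) *
      Real.sqrt (A + 1) ^ ((2 : ℝ) / 5) := by
    rw [← Real.rpow_add hs, Real.sqrt_eq_rpow, ← Real.rpow_mul hA1.le]
    norm_num
  rw [div_eq_iff (by positivity), e]
  unfold whF
  generalize Real.sqrt (A + 1) = s at hs
  have e2 : 2 * s / (1 + s) = s * (2 / (1 + s)) := by ring
  rw [e2, Real.mul_rpow hs.le (by positivity), eq_comm]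
  constructor <;> intro h <;> rw [← h] <;> ring

lemma wh_sqrt_mem (A : ℝ) (hA : A ∈ Set.Ioo (0 : ℝ) 15) :
    Real.sqrt (A + 1) ∈ Set.Ico (1 : ℝ) 4 := by
  constructor
  · rw [Real.one_le_sqrt]; linarith [hA.1]
  · rw [Real.sqrt_lt' (by norm_num)]; linarith [hA.2]

/-- For every depth ratio `Δ > 1` there is exactly one `A ∈ (0, 15)` solving the
Whitham modulation equation of El, Grimshaw and Smyth for the leading-wave amplitude
of an undular bore:
`Δ/(A + 1)^(1/4) = (3/(4 − √(A + 1)))^(21/10) · (2/(1 + √(A + 1)))^(2/5)`. -/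
theorem whitham_modulation_unique_amplitude (Δ : ℝ) (hΔ : 1 < Δ) :
    ∃! A : ℝ, A ∈ Set.Ioo (0 : ℝ) 15 ∧
      Δ / (A + 1) ^ ((1 : ℝ) / 4) =
        (3 / (4 - Real.sqrt (A + 1))) ^ ((21 : ℝ) / 10) *
          (2 / (1 + Real.sqrt (A + 1))) ^ ((2 : ℝ) / 5) := by
  have h0 : 0 < Δ := by linarith
  have h3 : 3 / Δ < 3 := by rw [div_lt_iff₀ h0]; linarith
  have h3' : 0 < 3 / Δ := by positivity
  obtain ⟨s, ⟨hs1, hs2⟩, hs⟩ := intermediate_value_Ioo (by linarith : (1 : ℝ) ≤ 4 - 3 / Δ)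
    (whF_cont (4 - 3 / Δ) (by linarith)) ⟨by rw [whF_one]; exact hΔ, whF_big Δ hΔ⟩
  have hm : s ^ 2 - 1 ∈ Set.Ioo (0 : ℝ) 15 := by constructor <;> nlinarith
  have hsq : Real.sqrt (s ^ 2 - 1 + 1) = s := by
    rw [sub_add_cancel, Real.sqrt_sq (by linarith)]
  refine ⟨s ^ 2 - 1, ⟨hm, (wh_iff _ _ hm).2 (by rw [hsq, hs])⟩, ?_⟩
  rintro B ⟨hB, hBe⟩
  rw [wh_iff _ _ hB] at hBe
  have hi := whF_strictMono.injOn (wh_sqrt_mem B hB) ⟨hs1.le, by linarith⟩ (hBe.trans hs.symm)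
  have := Real.sq_sqrt (by linarith [hB.1] : 0 ≤ B + 1)
  rw [hi] at this
  linarith
end

section
/- Let Δ > 0 and define G : [0, 15) → ℝ by G(A) = Δ/(A + 1)^{1/4} − (3/(4 − √(A + 1)))^{21/10} · (2/(1 + √(A + 1)))^{2/5}. Then G is strictly decreasing on [0, 15): for all 0 ≤ A₁ < A₂ < 15, G(A₂) < G(A₁). -/
theorem whitham_aux (s : ℝ) (h1 : 1 ≤ s) (h4 : s < 4) :
    (3 / (4 - s)) ^ ((21 : ℝ) / 10) * (2 / (1 + s)) ^ ((2 : ℝ) / 5) =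
      (3 / (4 - s)) ^ ((13 : ℝ) / 10) * (18 / ((4 - s) ^ 2 * (1 + s))) ^ ((2 : ℝ) / 5) := by
  have h5 : 0 < 4 - s := by linarith
  have h6 : 0 < 1 + s := by linarith
  have ha : 0 < 3 / (4 - s) := by positivity
  have e : 18 / ((4 - s) ^ 2 * (1 + s)) = (3 / (4 - s)) ^ (2 : ℝ) * (2 / (1 + s)) := by
    rw [Real.rpow_two]
    field_simp
    norm_num
  rw [e, Real.mul_rpow (by positivity) (by positivity), ← Real.rpow_mul ha.le, ← mul_assoc,
    ← Real.rpow_add ha]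
  norm_num

theorem whitham_aux_lt (s t : ℝ) (h1 : 1 ≤ s) (hst : s < t) (h4 : t < 4) :
    (3 / (4 - s)) ^ ((21 : ℝ) / 10) * (2 / (1 + s)) ^ ((2 : ℝ) / 5) <
    (3 / (4 - t)) ^ ((21 : ℝ) / 10) * (2 / (1 + t)) ^ ((2 : ℝ) / 5) := by
  rw [whitham_aux s h1 (by linarith), whitham_aux t (by linarith) h4]
  have h5 : 0 < 4 - s := by linarith
  have h6 : 0 < 1 + s := by linarith
  have h7 : 0 < 4 - t := by linarith
  have h8 : 0 < 1 + t := by linarith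
  have hp : (4 - t) ^ 2 * (1 + t) ≤ (4 - s) ^ 2 * (1 + s) := by
    obtain ⟨d, rfl⟩ : ∃ d, t = s + d := ⟨t - s, by ring⟩
    obtain ⟨p, rfl⟩ : ∃ p, s = 1 + p := ⟨s - 1, by ring⟩
    obtain ⟨q, hq⟩ : ∃ q, q = 3 - p - d := ⟨_, rfl⟩
    have hd : 0 < d := by linarith
    have hp : 0 ≤ p := by linarith
    have hq0 : 0 < q := by linarith
    obtain rfl : p = 3 - q - d := by linarith
    have : 0 ≤ d * (d * (3 - q - d) + 2 * q * (3 - q - d) + d + q * (3 - q - d) + q) := by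
      positivity
    nlinarith [mul_pos hd hq0, mul_pos hd hd, mul_nonneg hd.le hp,
      mul_nonneg (mul_pos hd hq0).le hp, mul_nonneg (mul_pos hd hd).le hp,
      mul_pos (mul_pos hd hq0) hd, mul_pos (mul_pos hd hq0) hq0, mul_pos (mul_pos hd hd) hd]
  apply mul_lt_mul
  · apply Real.rpow_lt_rpow (by positivity) _ (by norm_num)
    gcongr
  · apply Real.rpow_le_rpow (by positivity) _ (by norm_num)
    gcongr
  · positivity
  · positivity

/-- For `Δ > 0`, the function
`G(A) = Δ/(A + 1)^(1/4) − (3/(4 − √(A + 1)))^(21/10) · (2/(1 + √(A + 1)))^(2/5)`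
is strictly decreasing on `[0, 15)`. -/
theorem whitham_modulation_strictAntiOn (Δ : ℝ) (hΔ : 0 < Δ) :
    StrictAntiOn (fun A : ℝ =>
        Δ / (A + 1) ^ ((1 : ℝ) / 4) -
          (3 / (4 - Real.sqrt (A + 1))) ^ ((21 : ℝ) / 10) *
            (2 / (1 + Real.sqrt (A + 1))) ^ ((2 : ℝ) / 5))
      (Set.Ico (0 : ℝ) 15) := by
  rintro A ⟨hA, _⟩ B ⟨hB, hB'⟩ hAB
  have h1 := whitham_aux_lt (Real.sqrt (A + 1)) (Real.sqrt (B + 1))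
    (Real.one_le_sqrt.mpr (by linarith)) (Real.sqrt_lt_sqrt (by linarith) (by linarith))
    ((Real.sqrt_lt' (by norm_num)).mpr (by linarith))
  have h2 : Δ / (B + 1) ^ ((1 : ℝ) / 4) ≤ Δ / (A + 1) ^ ((1 : ℝ) / 4) := by
    have : 0 < A + 1 := by linarith
    gcongr
  dsimp only
  linarith
end

section
/- Let 0 < h0 < h1. Then there exists h2 with h0 < h2 < h1 satisfying the implicit shallow-water dam-break relation h2 = (h0/2)·( √( 1 + 8·( (2·h2/(h2 − h0)) · (√h1 − √h2)/√h0 )² ) − 1 ). -/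
/-- For `0 < h0 < h1` there exists an intermediate bore depth `h2 ∈ (h0, h1)` satisfying
the implicit shallow-water dam-break relation of Wu et al.:
`h2 = (h0/2)(√(1 + 8((2h2/(h2 − h0))·(√h1 − √h2)/√h0)²) − 1)`. -/
theorem shallow_water_dam_break_intermediate_depth (h0 h1 : ℝ)
    (h0pos : 0 < h0) (h01 : h0 < h1) :
    ∃ h2 : ℝ, h0 < h2 ∧ h2 < h1 ∧
      h2 = h0 / 2 *
        (Real.sqrt (1 + 8 * ((2 * h2 / (h2 - h0)) *
          ((Real.sqrt h1 - Real.sqrt h2) / Real.sqrt h0)) ^ 2) - 1) := by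
  have hs : √h0 < √h1 := Real.sqrt_lt_sqrt h0pos.le h01
  have hc : ContinuousOn (fun x : ℝ => (x + h0) * (x - h0) ^ 2 - 8 * h0 * x * (√h1 - √x) ^ 2)
      (Set.Icc h0 h1) := by fun_prop
  have h1pos : 0 < h1 := h0pos.trans h01
  have hmem : (0 : ℝ) ∈ Set.Ioo ((h0 + h0) * (h0 - h0) ^ 2 - 8 * h0 * h0 * (√h1 - √h0) ^ 2)
      ((h1 + h0) * (h1 - h0) ^ 2 - 8 * h0 * h1 * (√h1 - √h1) ^ 2) := by
    have a : 0 < √h1 - √h0 := sub_pos.2 hs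
    have b : 0 < h1 - h0 := sub_pos.2 h01
    constructor
    · have : 0 < 8 * h0 * h0 * (√h1 - √h0) ^ 2 := by positivity
      simpa using this
    · have : 0 < (h1 + h0) * (h1 - h0) ^ 2 := by positivity
      simpa using this
  obtain ⟨x, ⟨hx0, hx1⟩, hx⟩ := intermediate_value_Ioo h01.le hc hmem
  refine ⟨x, hx0, hx1, ?_⟩
  have hxp : 0 < x := h0pos.trans hx0
  have hne : x - h0 ≠ 0 := (sub_pos.2 hx0).ne'
  have key : 1 + 8 * ((2 * x / (x - h0)) * ((√h1 - √x) / √h0)) ^ 2 = (2 * x / h0 + 1) ^ 2 := by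
    rw [mul_pow, div_pow, div_pow, Real.sq_sqrt h0pos.le]
    have hx' : (x + h0) * (x - h0) ^ 2 - 8 * h0 * x * (√h1 - √x) ^ 2 = 0 := hx
    generalize (√h1 - √x) ^ 2 = T at hx'
    field_simp
    linear_combination (-4 * x) * hx'
  rw [key, Real.sqrt_sq (by positivity)]
  field_simp
  ring
end

section
/- Let n ≥ 1, Δx > 0 and h : Fin n → ℝ with h i > 0 for every i. Define the tridiagonal matrix A ∈ Matrix (Fin n) (Fin n) ℝ of the second-order finite difference discretisation of the Serre momentum equation by: A i i = h i + 2(h i)³/(3Δx²); A i j = −(h i)²/(2Δx) − (h i)³/(3Δx²) when j is the successor of i (i.e. (j : ℕ) = (i : ℕ) + 1); A i j = (h i)²/(2Δx) − (h i)³/(3Δx²) when j is the predecessor of i (i.e. (i : ℕ) = (j : ℕ) + 1); and A i j = 0 otherwise. Then A is strictly diagonally dominant by rows (for every i, the sum of |A i j| over j ≠ i is strictly less than |A i i|) and hence A is invertible. -/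
theorem sum_single_le_aux (n m : ℕ) (P : ℝ) (hP : 0 ≤ P) :
    ∑ j : Fin n, (if (j : ℕ) = m then P else 0) ≤ P := by
  rw [Fin.sum_univ_eq_sum_range (fun k => if k = m then P else 0) n, Finset.sum_ite_eq']
  split_ifs <;> simp [hP]

/-- The tridiagonal matrix of the second-order finite difference discretisation of the
Serre momentum equation (with `h i > 0` and `Δx > 0`) is strictly diagonally dominant
by rows and hence invertible. -/
theorem serre_fd_matrix_diagonally_dominant_invertible (n : ℕ) (hn : 1 ≤ n)
    (Δx : ℝ) (hΔx : 0 < Δx) (h : Fin n → ℝ) (hpos : ∀ i, 0 < h i)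
    (A : Matrix (Fin n) (Fin n) ℝ)
    (hA : ∀ i j : Fin n, A i j =
      if j = i then h i + 2 * h i ^ 3 / (3 * Δx ^ 2)
      else if (j : ℕ) = (i : ℕ) + 1 then
        -(h i ^ 2 / (2 * Δx)) - h i ^ 3 / (3 * Δx ^ 2)
      else if (i : ℕ) = (j : ℕ) + 1 then
        h i ^ 2 / (2 * Δx) - h i ^ 3 / (3 * Δx ^ 2)
      else 0) :
    (∀ i : Fin n, ∑ j ∈ Finset.univ.erase i, |A i j| < |A i i|) ∧ IsUnit A := by
  have key : ∀ i : Fin n, ∑ j ∈ Finset.univ.erase i, |A i j| < |A i i| := by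
    intro i
    have hi := hpos i
    have hd : A i i = h i + 2 * h i ^ 3 / (3 * Δx ^ 2) := by rw [hA]; simp
    have ha : 0 < h i ^ 2 / (2 * Δx) := by positivity
    have hb : 0 < h i ^ 3 / (3 * Δx ^ 2) := by positivity
    have e2 : 2 * h i ^ 3 / (3 * Δx ^ 2) = 2 * (h i ^ 3 / (3 * Δx ^ 2)) := by ring
    have hab : 2 * (h i ^ 2 / (2 * Δx)) < h i + 2 * (h i ^ 3 / (3 * Δx ^ 2)) := by
      have e : h i + 2 * (h i ^ 3 / (3 * Δx ^ 2)) - 2 * (h i ^ 2 / (2 * Δx))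
          = h i * (2 / 3 * (h i / Δx - 3 / 4) ^ 2 + 5 / 8) := by
        field_simp
        ring
      have : 0 < h i * (2 / 3 * (h i / Δx - 3 / 4) ^ 2 + 5 / 8) := by positivity
      linarith
    rw [hd, e2]
    have hAi := hA i
    generalize h i ^ 2 / (2 * Δx) = a at *
    generalize h i ^ 3 / (3 * Δx ^ 2) = b at *
    have h1 : ∑ j ∈ Finset.univ.erase i, |A i j| ≤ ∑ j ∈ Finset.univ.erase i,
        ((if (j : ℕ) = (i : ℕ) + 1 then |-a - b| else 0)
          + (if (j : ℕ) = (i : ℕ) - 1 then |a - b| else 0)) := by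
      refine Finset.sum_le_sum fun j hj => ?_
      rw [hAi j, if_neg (Finset.ne_of_mem_erase hj)]
      have p1 := abs_nonneg (-a - b)
      have p2 := abs_nonneg (a - b)
      split_ifs <;> first | omega | simp
    have h2 : ∑ j ∈ Finset.univ.erase i,
        ((if (j : ℕ) = (i : ℕ) + 1 then |-a - b| else 0)
          + (if (j : ℕ) = (i : ℕ) - 1 then |a - b| else 0)) ≤ ∑ j : Fin n,
        ((if (j : ℕ) = (i : ℕ) + 1 then |-a - b| else 0)
          + (if (j : ℕ) = (i : ℕ) - 1 then |a - b| else 0)) := by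
      refine Finset.sum_le_sum_of_subset_of_nonneg (Finset.erase_subset _ _) fun j _ _ => ?_
      positivity
    rw [Finset.sum_add_distrib] at h2
    have h3 := sum_single_le_aux n ((i : ℕ) + 1) |-a - b| (abs_nonneg _)
    have h4 := sum_single_le_aux n ((i : ℕ) - 1) |a - b| (abs_nonneg _)
    have h5 : |-a - b| + |a - b| < h i + 2 * b := by
      rw [abs_of_neg (show -a - b < 0 by linarith)]
      rcases abs_cases (a - b) with ⟨q, _⟩ | ⟨q, _⟩ <;> rw [q] <;> linarith
    rw [abs_of_pos (show 0 < h i + 2 * b by linarith)]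
    rw [Finset.sum_add_distrib] at h2 h1
    linarith
  refine ⟨key, ?_⟩
  rw [Matrix.isUnit_iff_isUnit_det, isUnit_iff_ne_zero]
  exact det_ne_zero_of_sum_row_lt_diag (by simpa only [Real.norm_eq_abs] using key)
end
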